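/- arXiv:math/9712289 — 2 statements merged into one kernel-verified Lean document; each statement's English description precedes it below -/
import Mathlib

section
/- For every infinite cardinal κ there exist an ultrafilter U on κ and a <_U-increasing sequence ⟨f_α : α < κ⁺⟩ of ordinal-valued functions on κ, together with a <_U-decreasing sequence ⟨g_α : α < κ⁺⟩ such that f_α <_U g_β for all α, β < κ⁺ (every g_β is a U-upper bound of the whole f-sequence), yet there is no h : κ → On with f_α <_U h <_U g_α for all α < κ⁺. -/
open Filter Set

/-- The set of points on which the functions `e x`, `x ∈ d`, agree with their values at `j`. -/
def cylinder {ι κ γ : Type*} (e : ι → κ → γ) (d : Finset ι) (j : κ) : Set κ :=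
  {i | ∀ x ∈ d, e x i = e x j}

/-- Modulo `F`, the cylinder of `d` around `j` is contained in `A` or disjoint from `A`. -/
def Decides {ι κ γ : Type*} (e : ι → κ → γ) (F : Filter κ) (d : Finset ι) (j : κ)
    (A : Set κ) : Prop :=
  (∀ᶠ i in F, i ∈ cylinder e d j → i ∈ A) ∨ ∀ᶠ i in F, i ∈ cylinder e d j → i ∉ A

/-- Every cylinder with coordinates below `β` can be refined, using coordinates below `β`,
to one that decides `A`. -/
def DecidedBelow {ι κ γ : Type*} [LT ι] (e : ι → κ → γ) (F : Filter κ) (β : ι)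
    (A : Set κ) : Prop :=
  ∀ d j, (∀ x ∈ d, x < β) →
    ∃ d', d ⊆ d' ∧ (∀ x ∈ d', x < β) ∧ ∃ j' ∈ cylinder e d j, Decides e F d' j' A

section Cylinder

variable {ι κ γ : Type*} {e : ι → κ → γ}

theorem self_mem_cylinder (d : Finset ι) (j : κ) : j ∈ cylinder e d j := fun _ _ => rfl

theorem cylinder_subset {d d' : Finset ι} {j j' : κ} (hd : d ⊆ d') (hj : j' ∈ cylinder e d j) :
    cylinder e d' j' ⊆ cylinder e d j :=
  fun _ hi x hx => (hi x (hd hx)).trans (hj x hx)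

theorem Decides.mono {F : Filter κ} {d d' : Finset ι} {j : κ} {A : Set κ}
    (h : Decides e F d j A) (hd : d ⊆ d') : Decides e F d' j A :=
  have hsub := cylinder_subset (e := e) hd (self_mem_cylinder d j)
  h.imp (fun h => h.mono fun _ hi hc => hi (hsub hc)) fun h => h.mono fun _ hi hc => hi (hsub hc)

/-- A filter that is maximal among those for which all cylinders are positive. -/
theorem exists_filter_decides (e : ι → κ → γ) : ∃ F : Filter κ,
    (∀ d j, ∃ᶠ i in F, i ∈ cylinder e d j) ∧
    ∀ A d j, ∃ d', d ⊆ d' ∧ ∃ j' ∈ cylinder e d j, Decides e F d' j' A := by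
  classical
  obtain ⟨F, hF⟩ := zorn_le₀
    (α := (Filter κ)ᵒᵈ) {F | ∀ d j, ∃ᶠ i in OrderDual.ofDual F, i ∈ cylinder e d j} (by
      intro c hc hchain
      rcases c.eq_empty_or_nonempty with rfl | hne
      · refine ⟨OrderDual.toDual ⊤, fun d j => ?_, by simp⟩
        simpa [frequently_top] using ⟨j, self_mem_cylinder d j⟩
      · refine ⟨OrderDual.toDual (sInf (OrderDual.ofDual ⁻¹' c : Set (Filter κ))), ?_,
          fun z hz => sInf_le (α := Filter κ) hz⟩
        intro d j hev
        have hdir : DirectedOn (· ≥ ·) (OrderDual.toDual ⁻¹' c : Set (Filter κ)) :=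
          fun x hx y hy => (hchain.directedOn x hx y hy)
        rw [OrderDual.ofDual_toDual, sInf_eq_iInf] at hev
        obtain ⟨G, hG, hmem⟩ := (mem_biInf_of_directed (f := id) hdir hne).1 hev
        exact hc hG d j hmem)
  refine ⟨OrderDual.ofDual F, hF.prop, fun A d j => ?_⟩
  set F₀ : Filter κ := OrderDual.ofDual F
  by_contra! hcon
  have hpos : ∀ d', d ⊆ d' → ∀ j' ∈ cylinder e d j,
      ∃ᶠ i in F₀, i ∈ cylinder e d' j' ∧ i ∈ A := by
    intro d' hd' j' hj' hev
    exact hcon d' hd' j' hj' (Or.inr (hev.mono fun i hi hc hA => hi ⟨hc, hA⟩))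
  have hle : F₀ ≤ F₀ ⊓ 𝓟 (A ∪ (cylinder e d j)ᶜ) := by
    refine hF.le_of_ge (y := OrderDual.toDual (F₀ ⊓ 𝓟 (A ∪ (cylinder e d j)ᶜ))) ?_
      (inf_le_left (α := Filter κ))
    intro r k
    simp only [OrderDual.ofDual_toDual, frequently_inf_principal]
    by_cases hm : ∃ m ∈ cylinder e d j, m ∈ cylinder e r k
    · obtain ⟨m, hm, hmr⟩ := hm
      refine (hpos (d ∪ r) Finset.subset_union_left m hm).mono fun i hi => ?_
      exact ⟨Or.inl hi.2, cylinder_subset Finset.subset_union_right hmr hi.1⟩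
    · push Not at hm
      exact (hF.prop r k).mono fun i hi => ⟨Or.inr fun h => hm i h hi, hi⟩
  have hmem := le_principal_iff.1 (hle.trans inf_le_right)
  refine hcon d subset_rfl j (self_mem_cylinder d j) (Or.inl ?_)
  filter_upwards [hmem] with i hi hc
  exact hi.resolve_right fun h => h hc

theorem exists_support {F : Filter κ} {A : Set κ}
    (hF : ∀ d j, ∃ d', d ⊆ d' ∧ ∃ j' ∈ cylinder e d j, Decides e F d' j' A) :
    ∃ t : κ → Finset ι, ∀ d j, ∃ j' ∈ cylinder e d j, Decides e F (t j') j' A := by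
  classical
  refine ⟨fun k => if h : ∃ d, Decides e F d k A then h.choose else ∅, fun d j => ?_⟩
  obtain ⟨d', -, j', hj', hdec⟩ := hF d j
  have h : ∃ d, Decides e F d j' A := ⟨d', hdec⟩
  exact ⟨j', hj', by simpa only [dif_pos h] using h.choose_spec⟩

theorem decidedBelow_of_support [LT ι] {F : Filter κ} {A : Set κ} {t : κ → Finset ι}
    (ht : ∀ d j, ∃ j' ∈ cylinder e d j, Decides e F (t j') j' A) {β : ι}
    (hβ : ∀ k, ∀ x ∈ t k, x < β) : DecidedBelow e F β A := by
  classical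
  intro d j hd
  obtain ⟨j', hj', hdec⟩ := ht d j
  refine ⟨d ∪ t j', Finset.subset_union_left, fun x hx => ?_, j', hj',
    hdec.mono Finset.subset_union_right⟩
  exact (Finset.mem_union.1 hx).elim (hd x) (hβ j' x)

end Cylinder

section Gap

variable {ι κ γ : Type*} {e : ι → κ → γ} {F : Filter κ}

/-- Refining a cylinder so that finitely many functions avoid a subinterval of prescribed
length. -/
theorem exists_avoiding_interval [LT ι] (β : ι) (K : Finset (κ → Ordinal))
    (hK : ∀ h ∈ K, ∀ n : ℕ, DecidedBelow e F β {i | h i ≤ n}) (N : ℕ) :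
    ∃ M : ℕ, ∀ d j (a b : ℕ), (∀ x ∈ d, x < β) → a + M ≤ b →
      ∃ d', d ⊆ d' ∧ (∀ x ∈ d', x < β) ∧ ∃ j' ∈ cylinder e d j, ∃ a' b' : ℕ,
        a ≤ a' ∧ a' + N ≤ b' ∧ b' ≤ b ∧
        ∀ h ∈ K, ∀ᶠ i in F, i ∈ cylinder e d' j' → h i ≤ a' ∨ b' ≤ h i := by
  classical
  induction K using Finset.induction_on generalizing N with
  | empty =>
    exact ⟨N, fun d j a b hd hab => ⟨d, subset_rfl, hd, j, self_mem_cylinder d j, a, b,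
      le_rfl, hab, le_rfl, by simp⟩⟩
  | insert h K _ ih =>
    obtain ⟨M, hM⟩ := ih (fun h' hh' => hK h' (Finset.mem_insert_of_mem hh')) (N + N)
    refine ⟨M, fun d j a b hd hab => ?_⟩
    obtain ⟨d₁, hd₁, hdβ, j₁, hj₁, a₁, b₁, ha, hab₁, hb, hav⟩ := hM d j a b hd hab
    obtain ⟨d₂, hd₂, hdβ₂, j₂, hj₂, hdec⟩ := hK h (Finset.mem_insert_self _ _) (a₁ + N) d₁ j₁ hdβ
    have hsub := cylinder_subset hd₂ hj₂
    have hj : j₂ ∈ cylinder e d j := cylinder_subset hd₁ hj₁ hj₂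
    rcases hdec with hdec | hdec
    · refine ⟨d₂, hd₁.trans hd₂, hdβ₂, j₂, hj, a₁ + N, b₁, by omega, by omega, hb, ?_⟩
      intro h' hh'
      rcases Finset.mem_insert.1 hh' with rfl | hh'
      · exact hdec.mono fun i hi hc => Or.inl (hi hc)
      · refine (hav h' hh').mono fun i hi hc => (hi (hsub hc)).imp_left fun hle => hle.trans ?_
        exact_mod_cast Nat.le_add_right _ _
    · refine ⟨d₂, hd₁.trans hd₂, hdβ₂, j₂, hj, a₁, a₁ + N, by omega, by omega, by omega, ?_⟩
      intro h' hh'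
      rcases Finset.mem_insert.1 hh' with rfl | hh'
      · exact hdec.mono fun i hi hc => Or.inr (not_le.1 (hi hc)).le
      · refine (hav h' hh').mono fun i hi hc => (hi (hsub hc)).imp_right fun hle => le_trans ?_ hle
        exact_mod_cast (by omega : a₁ + N ≤ b₁)

/-- The pairs `p x`, `x ∈ s`, are the endpoints of a strictly shrinking sequence of intervals. -/
def NestedOn [LT ι] (p : ι → ℕ × ℕ) (s : Finset ι) : Prop :=
  (∀ x ∈ s, (p x).1 < (p x).2) ∧
    ∀ x ∈ s, ∀ y ∈ s, x < y → (p x).1 < (p y).1 ∧ (p y).2 < (p x).2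

theorem NestedOn.mono [LT ι] {p : ι → ℕ × ℕ} {s s' : Finset ι} (h : NestedOn p s')
    (hs : s ⊆ s') : NestedOn p s :=
  ⟨fun x hx => h.1 x (hs hx), fun x hx y hy => h.2 x (hs hx) y (hs hy)⟩

theorem NestedOn.congr [LT ι] {p q : ι → ℕ × ℕ} {s : Finset ι} (h : NestedOn p s)
    (hpq : ∀ x ∈ s, q x = p x) : NestedOn q s := by
  refine ⟨fun x hx => ?_, fun x hx y hy => ?_⟩
  · rw [hpq x hx]; exact h.1 x hx
  · rw [hpq x hx, hpq y hy]; exact h.2 x hx y hy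

/-- Some cylinder forces, modulo `F`, that the intervals indexed by `s` are nested and avoid
the values of the functions in `K`. -/
theorem exists_cylinder_nested_avoiding [LinearOrder ι] {e : ι → κ → ℕ × ℕ} [Nonempty κ]
    (he : ∀ d j a, a ∉ d → ∀ v, ∃ i ∈ cylinder e d j, e a i = v)
    (K : Finset (κ → Ordinal)) (s : Finset ι) (N : ℕ) :
    ∃ d j, ∃ a b : ℕ, (∀ x ∈ d, ∃ y ∈ s, x ≤ y) ∧ s ⊆ d ∧ a + N ≤ b ∧
      (∀ x ∈ s, (e x j).1 ≤ a ∧ b ≤ (e x j).2) ∧ NestedOn (e · j) s ∧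
      ∀ h ∈ K, ∀ x ∈ s, (∀ n : ℕ, DecidedBelow e F x {i | h i ≤ n}) →
        ∀ᶠ i in F, i ∈ cylinder e d j → h i ≤ (e x i).1 ∨ (e x i).2 ≤ h i := by
  classical
  induction s using Finset.induction_on_max generalizing N with
  | empty =>
    exact ⟨∅, Classical.arbitrary κ, 0, N, by simp [NestedOn]⟩
  | insert β s hs ih =>
    obtain ⟨M, hM⟩ := exists_avoiding_interval (e := e) (F := F) β
      (K.filter fun h => ∀ n : ℕ, DecidedBelow e F β {i | h i ≤ n})
      (fun h hh => (Finset.mem_filter.1 hh).2) (N + 3)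
    obtain ⟨d, j, a, b, hd, hsd, hab, hin, hnest, hav⟩ := ih M
    obtain ⟨d₁, hd₁, hdβ, j₁, hj₁, a₁, b₁, ha, hab₁, hb, hav₁⟩ := hM d j a b
      (fun x hx => let ⟨y, hy, hxy⟩ := hd x hx; hxy.trans_lt (hs y hy)) hab
    obtain ⟨j₂, hj₂, hv⟩ := he d₁ j₁ β (fun h => (hdβ β h).false) (a₁ + 1, b₁ - 1)
    have hsub₁ : cylinder e (insert β d₁) j₂ ⊆ cylinder e d₁ j₁ :=
      cylinder_subset (Finset.subset_insert _ _) hj₂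
    have hsub : cylinder e (insert β d₁) j₂ ⊆ cylinder e d j :=
      hsub₁.trans (cylinder_subset hd₁ hj₁)
    have hval : ∀ x ∈ s, e x j₂ = e x j := fun x hx =>
      hsub (self_mem_cylinder _ _) x (hsd hx)
    have hin₂ : ∀ x ∈ s, (e x j₂).1 ≤ a ∧ b ≤ (e x j₂).2 := fun x hx => by
      rw [hval x hx]; exact hin x hx
    have hnest₂ := hnest.congr hval
    refine ⟨insert β d₁, j₂, a₁ + 1, b₁ - 1, ?_, ?_, by omega, ?_, ⟨?_, ?_⟩, ?_⟩
    · intro x hx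
      refine ⟨β, Finset.mem_insert_self _ _, ?_⟩
      rcases Finset.mem_insert.1 hx with rfl | hx
      · exact le_rfl
      · exact (hdβ x hx).le
    · exact Finset.insert_subset_insert _ (hsd.trans hd₁)
    · intro x hx
      rcases Finset.mem_insert.1 hx with rfl | hx
      · simp [hv]
      · have := hin₂ x hx
        omega
    · intro x hx
      rcases Finset.mem_insert.1 hx with rfl | hx
      · simp only [hv]; omega
      · exact hnest₂.1 x hx
    · intro x hx y hy hxy
      rcases Finset.mem_insert.1 hx with rfl | hxs <;>
        rcases Finset.mem_insert.1 hy with hyβ | hys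
      · exact absurd hxy hyβ.not_gt
      · exact absurd hxy (hs y hys).not_gt
      · have := hin₂ x hxs
        simp only [hyβ, hv]; omega
      · exact hnest₂.2 x hxs y hys hxy
    · intro h hh x hx hdec
      rcases Finset.mem_insert.1 hx with rfl | hx
      · filter_upwards [hav₁ h (Finset.mem_filter.2 ⟨hh, hdec⟩)] with i hi hc
        have hei : e x i = (a₁ + 1, b₁ - 1) := (hc x (Finset.mem_insert_self _ _)).trans hv
        rw [hei]
        exact (hi (hsub₁ hc)).imp (fun hle => hle.trans (Nat.cast_le.2 (Nat.le_succ a₁)))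
          fun hle => (Nat.cast_le.2 (Nat.sub_le b₁ 1)).trans hle
      · exact (hav h hh x hx hdec).mono fun i hi hc => hi (hsub hc)

/-- An ultrafilter for which the intervals are nested and no function stays strictly inside
all of them. -/
theorem exists_ultrafilter_nested_avoiding [LinearOrder ι] {e : ι → κ → ℕ × ℕ} [Nonempty κ]
    (he : ∀ d j a, a ∉ d → ∀ v, ∃ i ∈ cylinder e d j, e a i = v)
    (hbdd : ∀ t : κ × ℕ → Finset ι, ∃ β, ∀ k, ∀ x ∈ t k, x < β) :
    ∃ U : Ultrafilter κ, (∀ s : Finset ι, ∀ᶠ i in U, NestedOn (e · i) s) ∧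
      ∀ h : κ → Ordinal, ∃ x, ∀ᶠ i in U, h i ≤ (e x i).1 ∨ (e x i).2 ≤ h i := by
  classical
  obtain ⟨F, hpos, hdec⟩ := exists_filter_decides e
  let W : Finset ι × Finset (κ → Ordinal) → Set κ := fun p =>
    {i | NestedOn (e · i) p.1 ∧ ∀ h ∈ p.2, ∀ x ∈ p.1,
      (∀ n : ℕ, DecidedBelow e F x {i | h i ≤ n}) → h i ≤ (e x i).1 ∨ (e x i).2 ≤ h i}
  have hW : Antitone W := fun p q hpq i hi =>
    ⟨hi.1.mono hpq.1, fun h hh x hx => hi.2 h (hpq.2 hh) x (hpq.1 hx)⟩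
  have hne : ∀ p, (F ⊓ 𝓟 (W p)).NeBot := by
    rintro ⟨s, K⟩
    obtain ⟨d, j, -, -, -, hsd, -, -, hnest, hav⟩ :=
      exists_cylinder_nested_avoiding (F := F) he K s 0
    have hall : ∀ᶠ i in F, ∀ h ∈ K, ∀ x ∈ s, (∀ n : ℕ, DecidedBelow e F x {i | h i ≤ n}) →
        i ∈ cylinder e d j → h i ≤ (e x i).1 ∨ (e x i).2 ≤ h i := by
      simp only [Finset.eventually_all, eventually_imp_distrib_left]
      exact hav
    rw [← frequently_mem_iff_neBot]
    refine ((hpos d j).and_eventually hall).mono fun i hi => ?_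
    exact ⟨hnest.congr fun x hx => hi.1 x (hsd hx),
      fun h hh x hx hb => hi.2 h hh x hx hb hi.1⟩
  have hinf : (⨅ p, F ⊓ 𝓟 (W p)).NeBot := by
    refine iInf_neBot_of_directed' (Antitone.directed_ge fun p q hpq => ?_) hne
    exact inf_le_inf_left _ (principal_mono.2 (hW hpq))
  have hU : ∀ p, ∀ᶠ i in Ultrafilter.of (⨅ p, F ⊓ 𝓟 (W p)), i ∈ W p := fun p =>
    (Ultrafilter.of_le _).trans ((iInf_le _ p).trans inf_le_right) (mem_principal_self _)
  refine ⟨Ultrafilter.of (⨅ p, F ⊓ 𝓟 (W p)), fun s => (hU (s, ∅)).mono fun i hi => hi.1,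
    fun h => ?_⟩
  choose t ht using fun n : ℕ => exists_support (hdec {i | h i ≤ n})
  obtain ⟨β, hβ⟩ := hbdd fun p => t p.2 p.1
  refine ⟨β, (hU ({β}, {h})).mono fun i hi => ?_⟩
  exact hi.2 h (by simp) β (by simp) fun n => decidedBelow_of_support (ht n) fun k => hβ (k, n)

end Gap

section Existence

open Cardinal

universe u

/-- An independent family of functions on `κ`, indexed by the subsets of `κ`. -/
theorem exists_independent_family (κ : Type u) [Infinite κ] (γ : Type) [Countable γ] [Nonempty γ] :
    ∃ e : Set κ → κ → γ, ∀ d j a, a ∉ d → ∀ v, ∃ i ∈ cylinder e d j, e a i = v := by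
  classical
  obtain ⟨c, hc⟩ := exists_surjective_nat γ
  have hcard : #(Finset κ × (Finset κ →₀ ℕ)) = #κ := by simp
  obtain ⟨φ⟩ := Cardinal.eq.1 hcard
  let e : Set κ → κ → γ := fun S i =>
    c ((φ.symm i).2 ((φ.symm i).1.filter (· ∈ S)))
  have hsep : ∀ D : Finset (Set κ), ∃ s : Finset κ, ∀ S ∈ D, ∀ T ∈ D,
      s.filter (· ∈ S) = s.filter (· ∈ T) → S = T := by
    intro D
    have hx : ∀ S T : Set κ, ∃ x, (x ∈ S ↔ x ∈ T) → S = T := by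
      intro S T
      by_contra! hcon
      exact (hcon (Classical.arbitrary κ)).2 (Set.ext fun x => (hcon x).1)
    choose w hw using hx
    refine ⟨(D ×ˢ D).image fun p => w p.1 p.2, fun S hS T hT hST => hw S T ?_⟩
    have hmem : w S T ∈ (D ×ˢ D).image fun p => w p.1 p.2 :=
      Finset.mem_image.2 ⟨(S, T), Finset.mem_product.2 ⟨hS, hT⟩, rfl⟩
    have := Finset.ext_iff.1 hST (w S T)
    simpa only [Finset.mem_filter, hmem, true_and] using this
  refine ⟨e, fun d j a ha v => ?_⟩
  choose r hr using hc
  obtain ⟨s, hs⟩ := hsep (insert a d)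
  let val : Set κ → γ := fun S => if S = a then v else e S j
  let D : Finset (Finset κ) := (insert a d).image fun S => s.filter (· ∈ S)
  let g : Finset κ → ℕ := fun p =>
    if h : ∃ S ∈ insert a d, s.filter (· ∈ S) = p then r (val h.choose) else 0
  have hg : ∀ S ∈ insert a d, c (g (s.filter (· ∈ S))) = val S := by
    intro S hS
    have h : ∃ T ∈ insert a d, s.filter (· ∈ T) = s.filter (· ∈ S) := ⟨S, hS, rfl⟩
    simp only [g, dif_pos h, hr]
    rw [hs _ h.choose_spec.1 S hS h.choose_spec.2]
  let G : Finset κ →₀ ℕ := Finsupp.onFinset D g fun p hp => by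
    by_contra hpD
    refine hp (dif_neg ?_)
    rintro ⟨S, hS, rfl⟩
    exact hpD (Finset.mem_image_of_mem _ hS)
  have heval : ∀ S ∈ insert a d, e S (φ (s, G)) = val S := by
    intro S hS
    simpa [e, G] using hg S hS
  refine ⟨φ (s, G), fun x hx => ?_, ?_⟩
  · rw [heval x (Finset.mem_insert_of_mem hx)]
    exact if_neg fun h : x = a => ha (h ▸ hx)
  · rw [heval a (Finset.mem_insert_self _ _)]
    exact if_pos rfl

theorem exists_bound_succ_ord (κ : Type u) [Infinite κ]
    (t : κ × ℕ → Finset (Order.succ #κ).ord.ToType) :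
    ∃ β, ∀ k, ∀ x ∈ t k, x < β := by
  by_contra! hcon
  have hκ := aleph0_le_mk κ
  have hcover : (⋃ p : (Σ k, t k), Iic (p.2 : (Order.succ #κ).ord.ToType)) = Set.univ := by
    refine eq_univ_of_forall fun β => ?_
    obtain ⟨k, x, hx, hβ⟩ := hcon β
    exact mem_iUnion.2 ⟨⟨k, x, hx⟩, hβ⟩
  have hIic (x : (Order.succ #κ).ord.ToType) : #(Iic x) ≤ #κ := by
    rw [← Iio_insert]
    exact (mk_insert_le).trans (add_le_of_le hκ
      (Order.lt_succ_iff.1 (by simpa using mk_Iio_lt x (by simp))) (one_le_aleph0.trans hκ))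
  have hindex : #(Σ k, t k) ≤ #κ := by
    rw [mk_sigma]
    refine (sum_le_sum _ (fun _ => ℵ₀) fun k => (mk_le_aleph0)).trans ?_
    simp [hκ]
  have hle : #(Order.succ #κ).ord.ToType ≤ #κ := by
    rw [← mk_univ, ← hcover]
    refine (mk_iUnion_le _).trans ?_
    exact mul_le_of_le hκ hindex (ciSup_le' fun p => hIic p.2)
  rw [mk_ord_toType] at hle
  exact (Order.lt_succ #κ).not_ge hle

end Existence


/-- For every infinite κ there are an ultrafilter U on κ, a <_U-increasing sequence
⟨f_α : α < κ⁺⟩ and a <_U-decreasing sequence ⟨g_α : α < κ⁺⟩ of ordinal functions,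
with every g_β a strict U-upper bound of every f_α, but with no h satisfying
f_α <_U h <_U g_α for all α < κ⁺. -/
theorem counterexample_no_interpolant (κ : Type u) [Infinite κ] :
    ∃ (U : Ultrafilter κ) (f g : Ordinal → κ → Ordinal),
      (∀ α β : Ordinal, α < β → β < (Order.succ (Cardinal.mk κ)).ord →
        {i | f β i ≤ f α i} ∉ U) ∧
      (∀ α β : Ordinal, α < β → β < (Order.succ (Cardinal.mk κ)).ord →
        {i | g α i ≤ g β i} ∉ U) ∧
      (∀ α β : Ordinal, α < (Order.succ (Cardinal.mk κ)).ord →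
        β < (Order.succ (Cardinal.mk κ)).ord → {i | g β i ≤ f α i} ∉ U) ∧
      ¬ ∃ h : κ → Ordinal, ∀ α < (Order.succ (Cardinal.mk κ)).ord,
          {i | h i ≤ f α i} ∉ U ∧ {i | g α i ≤ h i} ∉ U := by
  classical
  obtain ⟨e₀, he₀⟩ := exists_independent_family κ (ℕ × ℕ)
  set o := (Order.succ (Cardinal.mk κ)).ord with ho
  have hcard : Cardinal.mk o.ToType ≤ Cardinal.mk (Set κ) := by
    rw [ho, Cardinal.mk_ord_toType, Cardinal.mk_set]
    exact Order.succ_le_of_lt (Cardinal.cantor _)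
  obtain ⟨ψ⟩ := hcard
  let e : o.ToType → κ → ℕ × ℕ := fun x => e₀ (ψ x)
  have he : ∀ d j a, a ∉ d → ∀ v, ∃ i ∈ cylinder e d j, e a i = v := by
    intro d j a ha v
    obtain ⟨i, hi, hv⟩ := he₀ (d.map ψ) j (ψ a) (by simpa using ha) v
    exact ⟨i, fun x hx => hi (ψ x) (Finset.mem_map_of_mem ψ hx), hv⟩
  obtain ⟨U, hU, hgap⟩ := exists_ultrafilter_nested_avoiding he (exists_bound_succ_ord κ)
  let E : Ordinal → κ → ℕ × ℕ := fun α i =>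
    if h : α < o then e (Ordinal.ToType.mk ⟨α, h⟩) i else 0
  have hE : ∀ {α} (h : α < o) i, E α i = e (Ordinal.ToType.mk ⟨α, h⟩) i := fun h i => dif_pos h
  have hnest : ∀ {α β : Ordinal}, α < β → β < o →
      ∀ᶠ i in U, (E α i).1 < (E β i).1 ∧ (E β i).2 < (E α i).2 := by
    intro α β hαβ hβ
    have hα := hαβ.trans hβ
    filter_upwards [hU {Ordinal.ToType.mk ⟨α, hα⟩, Ordinal.ToType.mk ⟨β, hβ⟩}] with i hi
    rw [hE hα, hE hβ]
    exact hi.2 _ (by simp) _ (by simp) (Ordinal.ToType.mk.lt_iff_lt.2 hαβ)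
  have hself : ∀ {α : Ordinal}, α < o → ∀ᶠ i in U, (E α i).1 < (E α i).2 := by
    intro α hα
    filter_upwards [hU {Ordinal.ToType.mk ⟨α, hα⟩}] with i hi
    rw [hE hα]
    exact hi.1 _ (by simp)
  refine ⟨U, fun α i => (E α i).1, fun α i => (E α i).2, ?_, ?_, ?_, ?_⟩
  · intro α β hαβ hβ
    rw [← Ultrafilter.compl_mem_iff_notMem]
    filter_upwards [hnest hαβ hβ] with i hi
    simpa using hi.1
  · intro α β hαβ hβ
    rw [← Ultrafilter.compl_mem_iff_notMem]
    filter_upwards [hnest hαβ hβ] with i hi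
    simpa using hi.2
  · intro α β hα hβ
    rw [← Ultrafilter.compl_mem_iff_notMem]
    have hlt : ∀ᶠ i in U, (E α i).1 < (E β i).2 := by
      rcases lt_trichotomy α β with hαβ | rfl | hβα
      · filter_upwards [hnest hαβ hβ, hself hβ] with i h₁ h₂ using h₁.1.trans h₂
      · exact hself hα
      · filter_upwards [hnest hβα hα, hself hα] with i h₁ h₂ using h₂.trans h₁.2
    filter_upwards [hlt] with i hi
    simpa using hi
  · rintro ⟨h, hh⟩
    obtain ⟨x, hx⟩ := hgap h
    obtain ⟨⟨α, hα⟩, rfl⟩ := Ordinal.ToType.mk.surjective x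
    have hα' : α < o := hα
    obtain ⟨h₁, h₂⟩ := hh α hα'
    rcases Ultrafilter.eventually_or.1 hx with hx | hx
    · exact h₁ (by simp only [hE hα']; exact hx)
    · exact h₂ (by simp only [hE hα']; exact hx)
end

section
/- For every infinite cardinal κ there exist an ultrafilter U over κ and a <_U-increasing sequence ⟨f_α : α < κ⁺⟩ of ordinal functions on κ such that: (1) ⟨f_α⟩ has no exact upper bound f mod U with cf(f(i)) > κ for all i (indeed no exact upper bound at all); (2) there are no sets S(i) of size ≤ κ as in the 'bounding by small sets' alternative; (3) for no g : κ → On does the sequence t_α = {i : f_α(i) > g(i)} fail to stabilize mod U. Hence the hypothesis λ ≥ κ⁺⁺ in the Trichotomy Theorem cannot be weakened to λ ≥ κ⁺. -/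
open Cardinal Ordinal Filter

/-- The value in base `Ω` of a list of ordinals whose least significant entry comes first, an
entry `d` standing for the digit `d + 1`. -/
noncomputable def digitCode (Ω : Ordinal.{u}) : List Ordinal.{u} → Ordinal.{u}
  | [] => 0
  | d :: l => Ω * digitCode Ω l + (d + 1)

theorem le_digitCode_append (Ω : Ordinal.{u}) (r l : List Ordinal.{u}) :
    Ω ^ r.length * digitCode Ω l ≤ digitCode Ω (r ++ l) := by
  induction r with
  | nil => simp
  | cons d r ih =>
    rw [List.length_cons, pow_succ', mul_assoc, List.cons_append, digitCode]
    exact (mul_le_mul_right ih Ω).trans le_self_add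

theorem digitCode_append_lt {Ω : Ordinal.{u}} (r l : List Ordinal.{u})
    (hr : ∀ d ∈ r, d + 1 < Ω) :
    digitCode Ω (r ++ l) < Ω ^ r.length * (digitCode Ω l + 1) := by
  induction r with
  | nil => simp
  | cons d r ih =>
    rw [List.length_cons, pow_succ', mul_assoc, List.cons_append, digitCode]
    have h := ih fun x hx => hr x (List.mem_cons_of_mem _ hx)
    calc Ω * digitCode Ω (r ++ l) + (d + 1) < Ω * digitCode Ω (r ++ l) + Ω :=
          (add_lt_add_iff_left _).2 (hr d List.mem_cons_self)
      _ = Ω * (digitCode Ω (r ++ l) + 1) := by rw [mul_add, mul_one]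
      _ ≤ _ := mul_le_mul_right (Order.add_one_le_of_lt h) Ω

theorem Finset.sort_ge_eq_append {α : Type*} [LinearOrder α] {s : Finset α} {a : α} (ha : a ∈ s) :
    s.sort (· ≥ ·) =
      (s.filter (a < ·)).sort (· ≥ ·) ++ a :: (s.filter (· < a)).sort (· ≥ ·) := by
  set l := (s.filter (a < ·)).sort (· ≥ ·) ++ a :: (s.filter (· < a)).sort (· ≥ ·) with hl
  have hlt : l.Pairwise (· > ·) := by
    rw [hl, List.pairwise_append, List.pairwise_cons]
    have hs : ∀ t : Finset α, (t.sort (· ≥ ·)).Pairwise (· > ·) := fun t =>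
      ((t.pairwise_sort (· ≥ ·)).and (t.sort_nodup (· ≥ ·))).imp
        fun h => lt_of_le_of_ne h.1 h.2.symm
    refine ⟨hs _, ⟨fun x hx => ?_, hs _⟩, fun x hx y hy => ?_⟩
    · simp only [Finset.mem_sort, Finset.mem_filter] at hx
      exact hx.2
    · simp only [Finset.mem_sort, Finset.mem_filter, List.mem_cons] at hx hy
      rcases hy with rfl | hy
      · exact hx.2
      · exact hy.2.trans hx.2
  have hfin : l.toFinset = s := by
    ext x
    simp only [hl, List.mem_toFinset, List.mem_append, List.mem_cons, Finset.mem_sort,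
      Finset.mem_filter]
    rcases lt_trichotomy x a with h | rfl | h
    · simp [h, h.not_gt, h.ne]
    · simp [ha]
    · simp [h, h.not_gt, h.ne']
  rw [← hfin]
  exact (List.toFinset_sort (· ≥ ·) (hlt.imp fun h => h.ne')).2 (hlt.imp fun h => h.le)

/-- The ordinal whose base `Ω` expansion of length `m` starts with the digits `a + 1` for `a ∈ s`,
in increasing order of `a`, and continues with zeros. -/
noncomputable def finsetCode (Ω : Ordinal.{u}) (m : ℕ) (s : Finset Ordinal.{u}) : Ordinal.{u} :=
  Ω ^ (m - s.card) * digitCode Ω (s.sort (· ≥ ·))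

/-- The ordinal obtained from `finsetCode Ω m s` by letting the first free digit be `a`. -/
noncomputable def finsetCodeSnoc (Ω : Ordinal.{u}) (m : ℕ) (s : Finset Ordinal.{u})
    (a : Ordinal.{u}) : Ordinal.{u} :=
  Ω ^ (m - s.card - 1) * (Ω * digitCode Ω (s.sort (· ≥ ·)) + a)

theorem finsetCodeSnoc_lt {Ω : Ordinal.{u}} (hΩ : 0 < Ω) (m : ℕ) (s : Finset Ordinal.{u})
    {a b : Ordinal.{u}} (h : a < b) : finsetCodeSnoc Ω m s a < finsetCodeSnoc Ω m s b :=
  mul_lt_mul_of_pos_left ((add_lt_add_iff_left _).2 h) (pow_pos hΩ _)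

theorem finsetCode_bounds {Ω : Ordinal.{u}} (hΩ : Order.IsSuccLimit Ω) {m : ℕ}
    {s : Finset Ordinal.{u}} {a : Ordinal.{u}} (hm : s.card ≤ m) (hs : ∀ x ∈ s, x < Ω)
    (ha : a ∈ s) :
    finsetCode Ω m (s.filter (· < a)) < finsetCodeSnoc Ω m (s.filter (· < a)) (a + 1) ∧
    finsetCodeSnoc Ω m (s.filter (· < a)) (a + 1) ≤ finsetCode Ω m s ∧
    finsetCode Ω m s < finsetCodeSnoc Ω m (s.filter (· < a)) (a + 1 + 1) := by
  have hΩ0 : 0 < Ω := hΩ.bot_lt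
  set t := s.filter (· < a) with ht
  set r := s.filter (a < ·) with hr
  have hsort : s.sort (· ≥ ·) = r.sort (· ≥ ·) ++ a :: t.sort (· ≥ ·) := Finset.sort_ge_eq_append ha
  have hcard : s.card = r.card + (t.card + 1) := by
    simpa using congrArg List.length hsort
  have hcode : finsetCode Ω m s =
      Ω ^ (m - s.card) * digitCode Ω (r.sort (· ≥ ·) ++ a :: t.sort (· ≥ ·)) := by
    rw [finsetCode, hsort]
  have hpow : Ω ^ (m - t.card - 1) = Ω ^ (m - s.card) * Ω ^ (r.sort (· ≥ ·)).length := by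
    rw [← pow_add, Finset.length_sort]
    congr 1
    omega
  refine ⟨?_, ?_, ?_⟩
  · have h1 : m - t.card = (m - t.card - 1) + 1 := by omega
    rw [finsetCode, finsetCodeSnoc, h1, pow_succ, mul_assoc, Nat.add_sub_cancel]
    exact mul_lt_mul_of_pos_left (lt_add_of_pos_right _ (by simp)) (pow_pos hΩ0 _)
  · rw [hcode, finsetCodeSnoc, hpow, mul_assoc]
    exact mul_le_mul_right (le_digitCode_append Ω _ (a :: t.sort (· ≥ ·))) _
  · rw [hcode, finsetCodeSnoc, hpow, mul_assoc, ← add_assoc]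
    refine mul_lt_mul_of_pos_left (digitCode_append_lt _ (a :: t.sort (· ≥ ·)) fun d hd => ?_)
      (pow_pos hΩ0 _)
    rw [Finset.mem_sort, hr, Finset.mem_filter] at hd
    exact hΩ.add_one_lt (hs d hd.1)

theorem le_div_mod_of_mem_Ico {Ω : Ordinal.{u}} (hΩ : 0 < Ω) {m : ℕ} {s : Finset Ordinal.{u}}
    {a x : Ordinal.{u}} (hx : x ∈ Set.Ico (finsetCodeSnoc Ω m s a) (finsetCodeSnoc Ω m s Ω)) :
    a ≤ x / Ω ^ (m - s.card - 1) % Ω := by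
  have hp : Ω ^ (m - s.card - 1) ≠ 0 := (pow_pos hΩ _).ne'
  obtain ⟨h1, h2⟩ := hx
  rw [finsetCodeSnoc, Ordinal.mul_le_iff_le_div hp] at h1
  rw [finsetCodeSnoc, Ordinal.lt_mul_iff_div_lt hp] at h2
  set q := x / Ω ^ (m - s.card - 1)
  have hq : q / Ω = digitCode Ω (s.sort (· ≥ ·)) :=
    Ordinal.div_eq (le_self_add.trans h1) (by rwa [mul_add, mul_one])
  rw [← Ordinal.div_add_mod q Ω, hq] at h1
  exact (add_le_add_iff_left _).1 h1

theorem exists_subset_range {κ : Type u} [Nonempty κ] (s : Set Ordinal.{u})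
    (hs : #s ≤ Cardinal.lift.{u + 1} #κ) : ∃ g : κ → Ordinal.{u}, s ⊆ Set.range g := by
  rcases s.eq_empty_or_nonempty with rfl | h
  · exact ⟨fun _ => 0, Set.empty_subset _⟩
  · have := h.to_subtype
    obtain ⟨e⟩ := Cardinal.lift_mk_le'.1 ((Cardinal.lift_id'.{u, u + 1} #s).trans_le hs)
    exact ⟨fun k => (Function.invFun e k : s), fun x hx =>
      ⟨e ⟨x, hx⟩, congrArg Subtype.val (Function.leftInverse_invFun e.injective _)⟩⟩

/-- If `S i` has size at most `κ` for each `i : κ`, then the base `κ⁺` digits of the elements of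
the sets `S i` are bounded below `κ⁺`. -/
theorem exists_forall_notMem_Ico {κ : Type u} [Infinite κ] (S : κ → Set Ordinal.{u})
    (hS : ∀ i, #(S i) ≤ Cardinal.lift.{u + 1} #κ) :
    ∃ δ < (Order.succ #κ).ord, ∀ i, ∀ x ∈ S i, ∀ (m : ℕ) (s : Finset Ordinal.{u}),
      x ∉ Set.Ico (finsetCodeSnoc (Order.succ #κ).ord m s (δ + 1))
        (finsetCodeSnoc (Order.succ #κ).ord m s (Order.succ #κ).ord) := by
  set Ω := (Order.succ #κ).ord with hΩdef
  have hreg : Cardinal.IsRegular (Order.succ #κ) := isRegular_succ (aleph0_le_mk κ)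
  have hΩ : 0 < Ω := hreg.ord_pos
  choose g hg using fun i => exists_subset_range (S i) (hS i)
  let D : κ × κ × ℕ → Ordinal.{u} := fun p => g p.1 p.2.1 / Ω ^ p.2.2 % Ω
  have hD : ∀ p, D p < Ω := fun p => Ordinal.mod_lt _ hΩ.ne'
  have hcard : #(κ × κ × ℕ) < Order.succ #κ := by
    refine Order.lt_succ_of_le ?_
    simp [mul_aleph0_eq (aleph0_le_mk κ), mul_eq_self (aleph0_le_mk κ)]
  refine ⟨⨆ p, D p, Ordinal.iSup_lt_of_lt_cof (by rwa [hreg.cof_ord]) hD, ?_⟩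
  intro i x hx m s hmem
  obtain ⟨k, rfl⟩ := hg i hx
  have h1 := le_div_mod_of_mem_Ico hΩ hmem
  have h2 : D (i, k, m - s.card - 1) ≤ ⨆ p, D p := Ordinal.le_iSup D _
  exact absurd (h1.trans h2) (not_le.2 (lt_add_one _))

theorem exists_injOn_set (κ : Type u) :
    ∃ Y : Ordinal.{u} → Set κ, Set.InjOn Y (Set.Iio (Order.succ #κ).ord) := by
  have h : #(Set.Iio (Order.succ #κ).ord) ≤ Cardinal.lift.{u + 1} #(Set κ) := by
    rw [Cardinal.mk_Iio_ordinal, Cardinal.lift_le, Cardinal.card_ord, Cardinal.mk_set]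
    exact Order.succ_le_of_lt (Cardinal.cantor _)
  obtain ⟨e⟩ := Cardinal.lift_mk_le'.1 ((Cardinal.lift_id'.{u, u + 1} _).trans_le h)
  refine ⟨fun α => open Classical in if h : α < (Order.succ #κ).ord then e ⟨α, h⟩ else ∅,
    fun α hα β hβ hab => ?_⟩
  simp only [Set.mem_Iio] at hα hβ
  simp only [hα, hβ, dite_true] at hab
  exact congrArg Subtype.val (e.injective hab)

/-- `κ` many indices suffice to realize all finite subsets of `κ⁺` by their initial segments. -/
theorem exists_finset_family (κ : Type u) [Infinite κ] :
    ∃ (A : Ordinal.{u} → κ → Finset Ordinal.{u}) (m : κ → ℕ),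
      (∀ β i, (A β i).card ≤ m i) ∧ (∀ β i, ∀ γ ∈ A β i, γ < β) ∧
      ∀ B : Finset Ordinal.{u}, (∀ β ∈ B, β < (Order.succ #κ).ord) →
        ∃ i, ∀ β ∈ B, A β i = B.filter (· < β) := by
  classical
  obtain ⟨Y, hY⟩ := exists_injOn_set κ
  have hp : ∀ β : Ordinal.{u}, ∃ p : κ → Ordinal.{u}, β < (Order.succ #κ).ord →
      ∀ γ < β, ∃ k, p k = γ := by
    intro β
    by_cases hβ : β < (Order.succ #κ).ord
    · obtain ⟨p, hp⟩ := exists_subset_range (κ := κ) (Set.Iio β) <| by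
        rw [Cardinal.mk_Iio_ordinal, Cardinal.lift_le]
        exact Order.le_of_lt_succ (Cardinal.lt_ord.1 hβ)
      exact ⟨p, fun _ γ hγ => hp hγ⟩
    · exact ⟨fun _ => 0, fun h => absurd h hβ⟩
  choose p hp using hp
  choose! e he using hp
  have hsep : ∀ V W : Set κ, ∃ x, V ≠ W → ¬(x ∈ V ↔ x ∈ W) := by
    intro V W
    by_cases h : V = W
    · exact ⟨Classical.arbitrary κ, fun h' => absurd h h'⟩
    · rw [Set.ext_iff, not_forall] at h
      exact h.imp fun _ hx _ => hx
  choose d hd using hsep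
  have hcard : #(Finset κ × Finset (Finset κ × κ)) = #κ := by
    simp [mul_eq_self (aleph0_le_mk κ)]
  obtain ⟨E⟩ := Cardinal.eq.1 hcard
  let A : Ordinal.{u} → Finset κ × Finset (Finset κ × κ) → Finset Ordinal.{u} := fun β t =>
    ((t.2.filter fun v => v.1 = t.1.filter (· ∈ Y β)).image fun v => p β v.2).filter (· < β)
  refine ⟨fun β i => A β (E.symm i), fun i => (E.symm i).2.card, fun β i => ?_, fun β i γ hγ => ?_,
    fun B hB => ?_⟩
  · exact (Finset.card_filter_le _ _).trans
      (Finset.card_image_le.trans (Finset.card_filter_le _ _))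
  · exact (Finset.mem_filter.1 hγ).2
  · let X : Finset κ := (B ×ˢ B).image fun q => d (Y q.1) (Y q.2)
    let R : Finset (Finset κ × κ) := ((B ×ˢ B).filter fun q => q.2 < q.1).image
      fun q => (X.filter (· ∈ Y q.1), e q.1 q.2)
    have hX : ∀ β ∈ B, ∀ β' ∈ B, X.filter (· ∈ Y β) = X.filter (· ∈ Y β') → β = β' := by
      intro β hβ β' hβ' h
      by_contra hne
      refine hd (Y β) (Y β') (fun h' => hne (hY (hB β hβ) (hB β' hβ') h')) ?_
      have hmem : d (Y β) (Y β') ∈ X :=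
        Finset.mem_image.2 ⟨(β, β'), Finset.mem_product.2 ⟨hβ, hβ'⟩, rfl⟩
      simpa [hmem] using Finset.ext_iff.1 h (d (Y β) (Y β'))
    refine ⟨E (X, R), fun β hβ => ?_⟩
    ext γ
    simp only [Equiv.symm_apply_apply, A, Finset.mem_filter, Finset.mem_image]
    refine and_congr_left fun hγβ => ⟨?_, fun hγ => ?_⟩
    · rintro ⟨v, ⟨hvR, hv⟩, rfl⟩
      obtain ⟨⟨β', γ'⟩, hq, rfl⟩ := Finset.mem_image.1 hvR
      simp only [Finset.mem_filter, Finset.mem_product] at hq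
      obtain rfl := hX β' hq.1.1 β hβ hv
      simpa only [he β' (hB β' hβ) γ' hq.2] using hq.1.2
    · refine ⟨(X.filter (· ∈ Y β), e β γ), ⟨Finset.mem_image.2 ⟨(β, γ), ?_, rfl⟩, rfl⟩,
        he β (hB β hβ) γ hγβ⟩
      simp [hβ, hγ, hγβ]

/-- There is an ultrafilter with a coherent sequence of length `κ⁺` of functions to finite sets. -/
theorem exists_coherent_finset_family (κ : Type u) [Infinite κ] :
    ∃ (U : Ultrafilter κ) (A : Ordinal.{u} → κ → Finset Ordinal.{u}) (m : κ → ℕ),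
      (∀ β i, (A β i).card ≤ m i) ∧ (∀ β i, ∀ γ ∈ A β i, γ < β) ∧
      ∀ α β, α < β → β < (Order.succ #κ).ord →
        ∀ᶠ i in U, α ∈ A β i ∧ (A β i).filter (· < α) = A α i := by
  classical
  obtain ⟨A, m, hcard, hlt, hA⟩ := exists_finset_family κ
  have hB : ∀ B : Finset (Set.Iio (Order.succ #κ).ord),
      ∃ i, ∀ β ∈ B.map (Function.Embedding.subtype _), A β i =
        (B.map (Function.Embedding.subtype _)).filter (· < β) := fun B =>
    hA _ fun β hβ => by
      obtain ⟨x, -, rfl⟩ := Finset.mem_map.1 hβ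
      exact x.2
  choose j hj using hB
  refine ⟨(Ultrafilter.of atTop).map j, A, m, hcard, hlt, fun α β hαβ hβ => ?_⟩
  refine Ultrafilter.of_le atTop ?_
  filter_upwards [eventually_ge_atTop
    ({⟨α, hαβ.trans hβ⟩, ⟨β, hβ⟩} : Finset (Set.Iio (Order.succ #κ).ord))] with B hBge
  have hαB : α ∈ B.map (Function.Embedding.subtype _) :=
    Finset.mem_map.2 ⟨⟨α, hαβ.trans hβ⟩, hBge (by simp), rfl⟩
  have hβB : β ∈ B.map (Function.Embedding.subtype _) :=
    Finset.mem_map.2 ⟨⟨β, hβ⟩, hBge (by simp), rfl⟩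
  show α ∈ A β (j B) ∧ (A β (j B)).filter (· < α) = A α (j B)
  rw [hj B α hαB, hj B β hβB, Finset.filter_filter]
  refine ⟨Finset.mem_filter.2 ⟨hαB, hαβ⟩, Finset.filter_congr fun x _ => ?_⟩
  exact ⟨fun h => h.2, fun h => ⟨h.trans hαβ, h⟩⟩


/-- The main theorem: for every infinite κ there are an ultrafilter U on κ and a
<_U-increasing sequence ⟨f_α : α < κ⁺⟩ of ordinal functions on κ violating all three
alternatives of the Trichotomy Theorem: (1) no exact upper bound mod U at all;
(2) no sets S(i) of size ≤ κ with interpolants h_α ∈ Π S(i), f_α <_U h_α <_U f_β;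
(3) for every g, the sequence t_α = {i : f_α(i) > g(i)} stabilizes mod U. -/
theorem trichotomy_optimal (κ : Type u) [Infinite κ] :
    ∃ (U : Ultrafilter κ) (f : Ordinal.{u} → κ → Ordinal.{u}),
      (∀ α β : Ordinal, α < β → β < (Order.succ (Cardinal.mk κ)).ord →
        {i | f β i ≤ f α i} ∉ U) ∧
      (¬ ∃ F : κ → Ordinal.{u},
        (∀ α < (Order.succ (Cardinal.mk κ)).ord, {i | F i < f α i} ∉ U) ∧
        (∀ h : κ → Ordinal.{u}, {i | F i ≤ h i} ∉ U →
          ∃ α < (Order.succ (Cardinal.mk κ)).ord, {i | f α i ≤ h i} ∉ U)) ∧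
      (¬ ∃ S : κ → Set Ordinal.{u},
        (∀ i, Cardinal.mk (S i) ≤ Cardinal.lift.{u + 1} (Cardinal.mk κ)) ∧
        ∀ α < (Order.succ (Cardinal.mk κ)).ord, ∃ h : κ → Ordinal.{u},
          (∀ i, h i ∈ S i) ∧ ∃ β < (Order.succ (Cardinal.mk κ)).ord,
            {i | h i ≤ f α i} ∉ U ∧ {i | f β i ≤ h i} ∉ U) ∧
      (∀ g : κ → Ordinal.{u}, ∃ αstar < (Order.succ (Cardinal.mk κ)).ord,
        ∀ α, αstar ≤ α → α < (Order.succ (Cardinal.mk κ)).ord →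
          ({i | g i < f α i} \ {i | g i < f αstar i}) ∉ U ∧
          ({i | g i < f αstar i} \ {i | g i < f α i}) ∉ U) := by
  obtain ⟨U, A, m, hcard, hlt, hA⟩ := exists_coherent_finset_family κ
  set Ω := (Order.succ #κ).ord with hΩdef
  have hΩ : Order.IsSuccLimit Ω := isSuccLimit_ord (isRegular_succ (aleph0_le_mk κ)).aleph0_le
  have hΩ0 : 0 < Ω := (isRegular_succ (aleph0_le_mk κ)).ord_pos
  have notMem_iff : ∀ {P : κ → Prop}, {i | P i} ∉ U ↔ ∀ᶠ i in U, ¬P i := fun {P} =>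
    Ultrafilter.compl_mem_iff_notMem.symm
  let f : Ordinal.{u} → κ → Ordinal.{u} := fun β i => finsetCode Ω (m i) (A β i)
  let L : Ordinal.{u} → Ordinal.{u} → κ → Ordinal.{u} := fun a α i =>
    finsetCodeSnoc Ω (m i) (A α i) a
  have hf : ∀ α β, α < β → β < Ω →
      ∀ᶠ i in U, f α i < L (α + 1) α i ∧ L (α + 1) α i ≤ f β i ∧ f β i < L (α + 1 + 1) α i := by
    intro α β hαβ hβ
    filter_upwards [hA α β hαβ hβ] with i ⟨hmem, heq⟩
    have := finsetCode_bounds hΩ (hcard β i) (fun x hx => (hlt β i x hx).trans hβ) hmem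
    rwa [heq] at this
  have hmono : ∀ α β, α < β → β < Ω → ∀ᶠ i in U, f α i < f β i := fun α β hαβ hβ =>
    (hf α β hαβ hβ).mono fun i h => h.1.trans_le h.2.1
  have hbound : ∀ δ < Ω, ∀ β < Ω, ∀ᶠ i in U, f β i < L (δ + 1 + 1) δ i := by
    intro δ hδ β hβ
    rcases lt_or_ge δ β with h | h
    · exact (hf δ β h hβ).mono fun i h => h.2.2
    · have hδ1 := hΩ.add_one_lt hδ
      filter_upwards [hf δ _ (lt_add_one δ) hδ1,
        hmono β _ (h.trans_lt (lt_add_one δ)) hδ1] with i h1 h2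
      exact h2.trans h1.2.2
  refine ⟨U, f, ?_, ?_, ?_, ?_⟩
  · intro α β hαβ hβ
    exact notMem_iff.2 ((hmono α β hαβ hβ).mono fun i => not_le_of_gt)
  · rintro ⟨F, hub, hleast⟩
    obtain ⟨δ, hδ, hout⟩ := exists_forall_notMem_Ico (fun i => {F i}) fun i => by
      simpa using one_le_aleph0.trans (aleph0_le_mk κ)
    have hδ1 := hΩ.add_one_lt hδ
    obtain ⟨α, hα, hFα⟩ := hleast (L (δ + 1 + 1) δ) <| notMem_iff.2 <| by
      filter_upwards [notMem_iff.1 (hub _ hδ1), hf δ _ (lt_add_one δ) hδ1] with i h1 h2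
      have h3 : L Ω δ i ≤ F i := by
        by_contra h
        exact hout i (F i) rfl (m i) (A δ i) ⟨h2.2.1.trans (not_lt.1 h1), not_le.1 h⟩
      exact not_le_of_gt ((finsetCodeSnoc_lt hΩ0 _ _ (hΩ.add_one_lt hδ1)).trans_le h3)
    obtain ⟨i, h1, h2⟩ := ((notMem_iff.1 hFα).and (hbound δ hδ α hα)).exists
    exact h1 h2.le
  · rintro ⟨S, hS, hinter⟩
    obtain ⟨δ, hδ, hout⟩ := exists_forall_notMem_Ico S hS
    have hδ1 := hΩ.add_one_lt hδ
    obtain ⟨h, hhS, β, hβ, h1, h2⟩ := hinter _ hδ1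
    obtain ⟨i, h1, h2, h3, h4⟩ := ((notMem_iff.1 h1).and ((notMem_iff.1 h2).and
      ((hf δ _ (lt_add_one δ) hδ1).and (hbound δ hδ β hβ)))).exists
    exact hout i (h i) (hhS i) (m i) (A δ i) ⟨h3.2.1.trans (not_le.1 h1).le,
      ((not_le.1 h2).trans h4).trans (finsetCodeSnoc_lt hΩ0 _ _ (hΩ.add_one_lt hδ1))⟩
  · intro g
    by_cases hg : ∃ α < Ω, {i | g i < f α i} ∈ U
    · obtain ⟨a, ha, hga⟩ := hg
      refine ⟨a, ha, fun α haα hα => ?_⟩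
      replace hga : ∀ᶠ i in U, g i < f a i := hga
      have hgα : ∀ᶠ i in U, g i < f α i := by
        rcases haα.eq_or_lt with rfl | h
        · exact hga
        · filter_upwards [hga, hmono a α h hα] with i h1 h2
          exact h1.trans h2
      exact ⟨notMem_iff.2 (hga.mono fun i hi h => h.2 hi),
        notMem_iff.2 (hgα.mono fun i hi h => h.2 hi)⟩
    · push Not at hg
      exact ⟨0, hΩ0, fun α _ hα => ⟨fun h => hg α hα (mem_of_superset h Set.sdiff_subset),
        fun h => hg 0 hΩ0 (mem_of_superset h Set.sdiff_subset)⟩⟩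
end
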